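/- Let g : ℝⁿ → ℝⁿ be an affine isometric bijection of Euclidean space with linear part L, and let μ be a Borel probability measure on ℝⁿ. Then the tangent space at the pushforward measure g_#μ is the image of the tangent space at μ under the map v ↦ L ∘ v ∘ g⁻¹; that is, T_{g_#μ} = {L ∘ v ∘ g⁻¹ : v ∈ T_μ}, as subsets of L²(g_#μ; ℝⁿ). -/

import Mathlib

open MeasureTheory ENNReal

/-- `ℝⁿ` as a Euclidean space. -/
abbrev Euc (n : ℕ) := EuclideanSpace ℝ (Fin n)

/-- The tangent space at `μ`: the `L²(μ)`-closure of gradients of smooth compactly supported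
functions. -/
noncomputable def tangentSpace {E : Type*} [NormedAddCommGroup E] [InnerProductSpace ℝ E]
    [CompleteSpace E] [MeasurableSpace E] (μ : Measure E) : Submodule ℝ (Lp E 2 μ) :=
  (Submodule.span ℝ {f : Lp E 2 μ | ∃ φ : E → ℝ, ContDiff ℝ (⊤ : ℕ∞) φ ∧ HasCompactSupport φ ∧
      (⇑f) =ᵐ[μ] gradient φ}).topologicalClosure

section Isometry

variable {E F : Type*} [NormedAddCommGroup E] [InnerProductSpace ℝ E]
  [NormedAddCommGroup F] [InnerProductSpace ℝ F]

theorem AffineIsometryEquiv.hasFDerivAt (g : E ≃ᵃⁱ[ℝ] F) (x : E) :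
    HasFDerivAt g (g.linearIsometryEquiv.toContinuousLinearEquiv : E →L[ℝ] F) x := by
  have hg : (g : E → F) = fun y => g.linearIsometryEquiv.toContinuousLinearEquiv y + g 0 := by
    ext1 y
    simpa using g.map_vadd 0 y
  rw [hg]
  exact g.linearIsometryEquiv.toContinuousLinearEquiv.hasFDerivAt.add_const _

theorem gradient_comp_affineIsometryEquiv_symm [CompleteSpace E] [CompleteSpace F]
    (g : E ≃ᵃⁱ[ℝ] F) {φ : E → ℝ} (hφ : Differentiable ℝ φ) (y : F) :
    gradient (φ ∘ g.symm) y = g.linearIsometryEquiv (gradient φ (g.symm y)) := by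
  refine HasGradientAt.gradient (hasGradientAt_iff_hasFDerivAt.2 ?_)
  have h := (hφ (g.symm y)).hasGradientAt.hasFDerivAt.comp y (g.symm.hasFDerivAt y)
  refine h.congr_fderiv ?_
  ext w
  have hsymm : g.symm.linearIsometryEquiv = g.linearIsometryEquiv.symm := rfl
  simpa [hsymm] using (g.linearIsometryEquiv.inner_map_map (gradient φ (g.symm y))
    (g.linearIsometryEquiv.symm w)).symm

variable [MeasurableSpace E] [MeasurableSpace F]

theorem exists_pushforward_Lp (g : E ≃ᵃⁱ[ℝ] F) {μ : Measure E} {ν : Measure F}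
    (hg : MeasurePreserving g.symm ν μ) :
    ∃ Φ : Lp E 2 μ →L[ℝ] Lp F 2 ν,
      ∀ v, Φ v =ᵐ[ν] fun y => g.linearIsometryEquiv (v (g.symm y)) := by
  refine ⟨((g.linearIsometryEquiv.toContinuousLinearEquiv : E →L[ℝ] F).compLpL 2 ν).comp
    (Lp.compMeasurePreservingₗᵢ ℝ g.symm hg).toContinuousLinearMap, fun v => ?_⟩
  filter_upwards [(g.linearIsometryEquiv.toContinuousLinearEquiv : E →L[ℝ] F).coeFn_compLpL
      (Lp.compMeasurePreserving g.symm hg v), Lp.coeFn_compMeasurePreserving v hg] with y h₁ h₂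
  refine h₁.trans ?_
  rw [h₂]
  rfl

theorem mem_tangentSpace_of_ae_eq_pushforward [CompleteSpace E] [CompleteSpace F]
    (g : E ≃ᵃⁱ[ℝ] F) {μ : Measure E} {ν : Measure F} (hg : MeasurePreserving g.symm ν μ)
    {v : Lp E 2 μ} (hv : v ∈ tangentSpace μ) {h : Lp F 2 ν}
    (hh : h =ᵐ[ν] fun y => g.linearIsometryEquiv (v (g.symm y))) : h ∈ tangentSpace ν := by
  obtain ⟨Φ, hΦ⟩ := exists_pushforward_Lp g hg
  obtain rfl : h = Φ v := Lp.ext (hh.trans (hΦ v).symm)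
  suffices H : tangentSpace μ ≤ (tangentSpace ν).comap (Φ : Lp E 2 μ →ₗ[ℝ] Lp F 2 ν) from H hv
  refine Submodule.topologicalClosure_minimal _ (Submodule.span_le.2 ?_)
    ((Submodule.isClosed_topologicalClosure _).preimage Φ.continuous)
  rintro f ⟨φ, hφ, hφc, hf⟩
  refine Submodule.le_topologicalClosure _ (Submodule.subset_span ⟨φ ∘ g.symm, ?_, ?_, ?_⟩)
  · exact hφ.comp g.symm.toAffineIsometry.toContinuousAffineMap.contDiff
  · exact hφc.comp_homeomorph g.symm.toHomeomorph
  · filter_upwards [hΦ f, hg.quasiMeasurePreserving.ae_eq_comp hf] with y h₁ h₂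
    rw [gradient_comp_affineIsometryEquiv_symm g (hφ.differentiable (by simp))]
    exact h₁.trans (congrArg g.linearIsometryEquiv h₂)

end Isometry

theorem tangentSpace_map_isometry {n : ℕ}
    (g : Euc n ≃ᵃⁱ[ℝ] Euc n) (μ : Measure (Euc n)) [IsProbabilityMeasure μ] :
    (tangentSpace (μ.map g) : Set (Lp (Euc n) 2 (μ.map g))) =
      {h : Lp (Euc n) 2 (μ.map g) | ∃ v : Lp (Euc n) 2 μ, v ∈ tangentSpace μ ∧
        (⇑h) =ᵐ[μ.map g] fun y => g.linearIsometryEquiv (v (g.symm y))} := by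
  have hg : MeasurePreserving g μ (μ.map g) := g.continuous.measurable.measurePreserving μ
  have hg' : MeasurePreserving g.symm (μ.map g) μ :=
    hg.symm g.toHomeomorph.toMeasurableEquiv
  ext h
  constructor
  · intro hh
    obtain ⟨Φ, hΦ⟩ := exists_pushforward_Lp g.symm hg
    refine ⟨Φ h, mem_tangentSpace_of_ae_eq_pushforward g.symm hg hh (hΦ h), ?_⟩
    filter_upwards [hg'.quasiMeasurePreserving.ae_eq_comp (hΦ h)] with y hy
    have hy' : Φ h (g.symm y) = g.linearIsometryEquiv.symm (h (g (g.symm y))) := hy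
    simp [hy']
  · rintro ⟨v, hv, hh⟩
    exact mem_tangentSpace_of_ae_eq_pushforward g hg' hv hh
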